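/- Let K < ∞. There exist constants m_K ∈ ℕ and D_K < ∞ depending only on K such that for every K-TSP-efficient tree T (a graph-theoretical tree with its weighted shortest-path metric, or more generally an ℝ-tree), the lamplighter space (La(T), d_La) admits a D_K-biLipschitz embedding into an ℓ1-product of at most m_K ℝ-trees. -/

import Mathlib

open Metric Set
open scoped Classical ENNReal NNReal

noncomputable section

/-- The underlying set of the lamplighter space over `X`: a lamp configuration
(a finite set of lit lamps) together with the position of the lamplighter. -/
abbrev Lamp (X : Type*) := Finset X × X

namespace Lamplighter

variable {X Y Z : Type*}

/-- The length of the path visiting the points of a list in order,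
with respect to the distance function `d`. -/
def pathLength (d : X → X → ℝ) : List X → ℝ
  | [] => 0
  | [_] => 0
  | x :: y :: l => d x y + pathLength d (y :: l)

/-- The symmetric difference of the lamp configurations of `p` and `q`, as a set. -/
def sd (p q : Lamp X) : Set X :=
  ((p.1 : Set X) \ (q.1 : Set X)) ∪ ((q.1 : Set X) \ (p.1 : Set X))

/-- The traveling salesman semimetric on the lamplighter space:
the infimum of lengths of finite paths starting at `p.2`, ending at `q.2`, and
visiting every point of the symmetric difference of the configurations. -/
def TSP (d : X → X → ℝ) (p q : Lamp X) : ℝ :=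
  sInf { s : ℝ | ∃ l : List X, l.head? = some p.2 ∧ l.getLast? = some q.2 ∧
    (∀ a ∈ sd p q, a ∈ l) ∧ s = pathLength d l }

/-- The diameter (in `ℝ≥0∞`) of a set with respect to a distance function `d`. -/
def ediamD (d : X → X → ℝ) (A : Set X) : ℝ≥0∞ :=
  ⨆ x ∈ A, ⨆ y ∈ A, ENNReal.ofReal (d x y)

/-- The traveling salesman shortcut semimetric:
`TSCP((A,x),(B,y)) = diam({x,y} ∪ (A Δ B))`. -/
def TSCP (d : X → X → ℝ) (p q : Lamp X) : ℝ :=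
  (ediamD d ({p.2, q.2} ∪ sd p q)).toReal

/-- `ρ((A,x),(B,y))` is `0` if `A = B` and `1` otherwise. -/
def rho (p q : Lamp X) : ℝ := if p.1 = q.1 then 0 else 1

/-- The lamplighter metric `d_La = TSP + ρ`. -/
def dLa (d : X → X → ℝ) (p q : Lamp X) : ℝ := TSP d p q + rho p q

/-- `X` is `K`-TSP-efficient if `TSP ≤ K • TSCP` on `La(X)²`. -/
def TSPEfficient (d : X → X → ℝ) (K : ℝ) : Prop :=
  ∀ p q : Lamp X, TSP d p q ≤ K * TSCP d p q

/-- A weak `C`-biLipschitz embedding between spaces with distance functions `dY`, `dZ`: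
a family of maps `φ t : Y → Z` (for `t > 0`) such that each `φ t` is `σ t`-Lipschitz
and `dY x y ≥ C*t` implies `dZ (φ t x) (φ t y) ≥ t * σ t`. -/
def WeakBiLip (dY : Y → Y → ℝ) (dZ : Z → Z → ℝ) (C : ℝ) : Prop :=
  ∃ φ : ℝ → Y → Z, ∀ t : ℝ, 0 < t → ∃ σ : ℝ, 0 < σ ∧
    (∀ x y : Y, dZ (φ t x) (φ t y) ≤ σ * dY x y) ∧
    (∀ x y : Y, C * t ≤ dY x y → t * σ ≤ dZ (φ t x) (φ t y))

/-- `f` is a `C`-biLipschitz embedding (an injective map of biLipschitz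
distortion at most `C`, allowing an overall scaling factor `s`). -/
def BiLipWith (dY : Y → Y → ℝ) (dZ : Z → Z → ℝ) (C : ℝ) (f : Y → Z) : Prop :=
  Function.Injective f ∧ ∃ s : ℝ, 0 < s ∧
    ∀ x y : Y, s * dY x y ≤ dZ (f x) (f y) ∧ dZ (f x) (f y) ≤ C * s * dY x y

/-- Nagata dimension at most `n` with constant at most `γ`: for every scale `s > 0`
there is a covering by sets of diameter at most `γ s` such that every set of diameter
less than `s` meets at most `n + 1` members of the covering. -/
def NagataDimD (d : Y → Y → ℝ) (n : ℕ) (γ : ℝ) : Prop :=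
  ∀ s : ℝ, 0 < s → ∃ B : Set (Set Y),
    (∀ y : Y, ∃ b ∈ B, y ∈ b) ∧
    (∀ b ∈ B, ediamD d b ≤ ENNReal.ofReal (γ * s)) ∧
    (∀ A : Set Y, ediamD d A < ENNReal.ofReal s →
      {b | b ∈ B ∧ (b ∩ A).Nonempty}.encard ≤ ((n : ℕ∞) + 1))

/-- Markov type 2 with constant `M`, for the distance function `d`: for every stationary
reversible Markov chain on a finite state space (given by a stationary distribution `μ`
and a reversible stochastic transition matrix `P`), every map `f` into the space, and
every time `t`, `E[d(f(Z_t),f(Z_0))²] ≤ M² t E[d(f(Z_1),f(Z_0))²]`. -/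
def HasMarkovType2 (d : Y → Y → ℝ) (M : ℝ) : Prop :=
  ∀ (n : ℕ) (μ : Fin n → ℝ) (P : Matrix (Fin n) (Fin n) ℝ),
    (∀ i, 0 ≤ μ i) → (∑ i, μ i) = 1 →
    (∀ i j, 0 ≤ P i j) → (∀ i, (∑ j, P i j) = 1) →
    (∀ i j, μ i * P i j = μ j * P j i) →
    ∀ (f : Fin n → Y) (t : ℕ),
      (∑ i, ∑ j, μ i * (P ^ t) i j * d (f i) (f j) ^ 2) ≤
        M ^ 2 * t * ∑ i, ∑ j, μ i * P i j * d (f i) (f j) ^ 2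

/-- `D`-doubling: every ball of radius `r` can be covered by `D` balls of radius `r/2`. -/
def Doubling (d : Y → Y → ℝ) (D : ℕ) : Prop :=
  ∀ r : ℝ, 0 < r → ∀ x : Y, ∃ c : Fin D → Y,
    ∀ y : Y, d x y ≤ r → ∃ i, d (c i) y ≤ r / 2

/-- `A` is an arc from `x` to `y`: the image of an injective continuous map of `[0,1]`
sending the endpoints to `x` and `y`. -/
def IsArc {T : Type*} [MetricSpace T] (x y : T) (A : Set T) : Prop :=
  ∃ γ : ℝ → T, ContinuousOn γ (Icc 0 1) ∧ InjOn γ (Icc 0 1) ∧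
    γ 0 = x ∧ γ 1 = y ∧ γ '' (Icc 0 1) = A

/-- `A` is a geodesic segment from `x` to `y`: the image of an isometric embedding
of `[0, dist x y]` sending the endpoints to `x` and `y`. -/
def IsGeodesicSeg {T : Type*} [MetricSpace T] (x y : T) (A : Set T) : Prop :=
  ∃ γ : ℝ → T, γ 0 = x ∧ γ (dist x y) = y ∧
    (∀ s ∈ Icc (0 : ℝ) (dist x y), ∀ t ∈ Icc (0 : ℝ) (dist x y),
      dist (γ s) (γ t) = |s - t|) ∧
    γ '' (Icc 0 (dist x y)) = A

/-- `T` is an ℝ-tree: any two (distinct) points are joined by a unique arc,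
and this arc is a geodesic. -/
def IsRTree (T : Type*) [MetricSpace T] : Prop :=
  ∀ x y : T, x ≠ y →
    (∃ A : Set T, IsArc x y A) ∧
    (∀ A A' : Set T, IsArc x y A → IsArc x y A' → A = A') ∧
    (∀ A : Set T, IsArc x y A → IsGeodesicSeg x y A)

/-- The sup (ℓ∞-product) distance on a finite product of metric spaces. -/
def piSupDist {n : ℕ} {T : Fin n → Type*} (I : ∀ i, MetricSpace (T i)) :
    (∀ i, T i) → (∀ i, T i) → ℝ :=
  letI := I
  fun f g => dist f g

/-- The ℓ1-product distance on a finite product of metric spaces. -/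
def piL1Dist {n : ℕ} {T : Fin n → Type*} (I : ∀ i, MetricSpace (T i)) :
    (∀ i, T i) → (∀ i, T i) → ℝ :=
  letI := I
  fun f g => ∑ i, dist (f i) (g i)

/-- The ℓ1 distance on `ℝ^m`. -/
def l1Dist (m : ℕ) (x y : Fin m → ℝ) : ℝ := ∑ i, |x i - y i|

/-- The ℓp distance on `ℝ^m`. -/
def lpDist (m : ℕ) (p : ℝ) (x y : Fin m → ℝ) : ℝ :=
  (∑ i, |x i - y i| ^ p) ^ (1 / p)

/-- The (pseudo)distance of the ℝ-star over the index type `ι`: the wedge sum of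
copies of `[0,∞)` indexed by `ι`, glued at `0`. -/
def starDist {ι : Type*} (p q : ι × ℝ≥0) : ℝ :=
  if p.1 = q.1 then |(p.2 : ℝ) - (q.2 : ℝ)| else (p.2 : ℝ) + (q.2 : ℝ)

/-- The sup (ℓ∞-product) of finitely many distance functions. -/
def supD {n : ℕ} {T : Fin n → Type*} (d : ∀ i, T i → T i → ℝ) (f g : ∀ i, T i) : ℝ :=
  ((Finset.univ.sup fun i => (d i (f i) (g i)).toNNReal : ℝ≥0) : ℝ)

/-- The infimum of distortions of biLipschitz embeddings of `(Y, dY)` into `(Z, dZ)`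
(`∞` if there is no such embedding). -/
def cEmb (dY : Y → Y → ℝ) (dZ : Z → Z → ℝ) : ℝ≥0∞ :=
  sInf { D : ℝ≥0∞ | ∃ C : ℝ, 0 < C ∧ D = ENNReal.ofReal C ∧
    ∃ f : Y → Z, BiLipWith dY dZ C f }

/-- `c_1^{m,dom}(X,d)`: the infimum of all `D > 0` such that there exist injective
`1`-Lipschitz maps `φ i : X → ℝ` and weights `α i ≥ 0` summing to `1` with
`∑ i, α i * |φ i x - φ i y| ≥ d x y / D` for all `x y` (`∞` if there is none). -/
def c1dom (d : X → X → ℝ) (m : ℕ) : ℝ≥0∞ :=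
  sInf { D : ℝ≥0∞ | ∃ C : ℝ, 0 < C ∧ D = ENNReal.ofReal C ∧
    ∃ (φ : Fin m → X → ℝ) (α : Fin m → ℝ),
      (∀ i, Function.Injective (φ i)) ∧
      (∀ i, ∀ x y : X, |φ i x - φ i y| ≤ d x y) ∧
      (∀ i, 0 ≤ α i) ∧ (∑ i, α i) = 1 ∧
      ∀ x y : X, d x y / C ≤ ∑ i, α i * |φ i x - φ i y| }

/-- The Hamming distance on the Hamming cube `{0,1}^M`, as a real number. -/
def hamDist {M : ℕ} (x y : Fin M → Bool) : ℝ :=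
  ((Finset.univ.filter fun i => x i ≠ y i).card : ℝ)

/-- The star graph `St_{n,k}`: the one-point coalescence of `n` paths of length `k`,
realized inside `ℤ^n` as the multiples `α eᵢ` with `0 ≤ α ≤ k`. -/
def St (n k : ℕ) : Type :=
  {x : Fin n → ℤ // ∃ i : Fin n, (∀ j : Fin n, j ≠ i → x j = 0) ∧ 0 ≤ x i ∧ x i ≤ (k : ℤ)}

/-- The ℓ1 metric on the star graph `St_{n,k}`. -/
def stDist {n k : ℕ} (x y : St n k) : ℝ := ∑ j, |(x.1 j : ℝ) - (y.1 j : ℝ)|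

/-- The endpoint `k eᵢ` of the `i`-th branch of the star graph. -/
def St.endpoint {n k : ℕ} (i : Fin n) : St n k :=
  ⟨fun j => if j = i then (k : ℤ) else 0, i, fun j hj => if_neg hj, by simp, by simp⟩

/-- The cycle metric on `ℤ/nℤ`. -/
def cycDist {n : ℕ} (a b : ZMod n) : ℝ := ((min ((a - b).val) ((b - a).val) : ℕ) : ℝ)

/-- The rectangular grid `G_{k,n} = ([0,k] ∩ ℤ) × ([0,n] ∩ ℤ)`. -/
def Grid2 (k n : ℕ) : Type :=
  {p : ℤ × ℤ // 0 ≤ p.1 ∧ p.1 ≤ (k : ℤ) ∧ 0 ≤ p.2 ∧ p.2 ≤ (n : ℤ)}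

/-- The ℓ1 metric on the grid `G_{k,n}`. -/
def grid2Dist {k n : ℕ} (x y : Grid2 k n) : ℝ :=
  |(x.1.1 : ℝ) - (y.1.1 : ℝ)| + |(x.1.2 : ℝ) - (y.1.2 : ℝ)|

/-- The `m`-dimensional grid `G^m({n_i}) = ∏ i, ([0, n_i] ∩ ℤ)`. -/
def GridM (m : ℕ) (n : Fin m → ℕ) : Type :=
  {p : Fin m → ℤ // ∀ i, 0 ≤ p i ∧ p i ≤ (n i : ℤ)}

/-- The ℓ1 metric on the `m`-dimensional grid. -/
def gridMDist {m : ℕ} {n : Fin m → ℕ} (x y : GridM m n) : ℝ :=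
  ∑ i, |(x.1 i : ℝ) - (y.1 i : ℝ)|

/-- The four-point condition characterising `0`-hyperbolic metric spaces. -/
def FourPoint (X : Type*) [PseudoMetricSpace X] : Prop :=
  ∀ o x y z : X, dist x z + dist o y ≤ max (dist x y + dist o z) (dist y z + dist o x)

/-- The metric segment between `x` and `y`. -/
def segm {X : Type*} [MetricSpace X] (x y : X) : Set X :=
  {z | dist x z + dist z y = dist x y}

/-- `γ` is a geodesic from `x` to `y` parametrised by arc length. -/
def IsGeod {X : Type*} [MetricSpace X] (x y : X) (γ : ℝ → X) : Prop :=
  γ 0 = x ∧ γ (dist x y) = y ∧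
    ∀ s ∈ Icc (0 : ℝ) (dist x y), ∀ t ∈ Icc (0 : ℝ) (dist x y), dist (γ s) (γ t) = |s - t|

section RTree

variable {X : Type*} [MetricSpace X]

theorem left_mem_segm (x y : X) : x ∈ segm x y := by simp [segm]

theorem right_mem_segm (x y : X) : y ∈ segm x y := by simp [segm]

theorem segm_comm (x y : X) : segm x y = segm y x := by
  ext z
  simp only [segm, mem_ofPred_eq]
  rw [dist_comm x z, dist_comm z y, dist_comm x y, add_comm]

theorem segm_subset_of_mem {x y c p : X} (hc : c ∈ segm x y) (hp : p ∈ segm c y) :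
    p ∈ segm x y := by
  simp only [segm, mem_ofPred_eq] at *
  have h1 := dist_triangle x c p
  have h2 := dist_triangle x p y
  linarith

theorem IsGeod.mem_segm {x y : X} {γ : ℝ → X} (h : IsGeod x y γ) {t : ℝ}
    (ht : t ∈ Icc (0 : ℝ) (dist x y)) :
    γ t ∈ segm x y ∧ dist x (γ t) = t := by
  obtain ⟨h0, h1, h2⟩ := h
  have e0 := h2 0 ⟨le_rfl, dist_nonneg⟩ t ht
  have e1 := h2 t ht (dist x y) ⟨dist_nonneg, le_rfl⟩
  rw [h0, zero_sub, abs_neg, abs_of_nonneg ht.1] at e0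
  rw [h1, abs_sub_comm, abs_of_nonneg (sub_nonneg.2 ht.2)] at e1
  refine ⟨?_, e0⟩
  simp only [segm, mem_ofPred_eq]
  linarith

theorem IsGeod.continuousOn {x y : X} {γ : ℝ → X} (h : IsGeod x y γ) :
    ContinuousOn γ (Icc 0 (dist x y)) := by
  have : LipschitzOnWith 1 γ (Icc 0 (dist x y)) :=
    LipschitzOnWith.of_dist_le_mul fun s hs t ht => by
      rw [h.2.2 s hs t ht, Real.dist_eq]; simp
  exact this.continuousOn

theorem IsGeod.isArc {x y : X} {γ : ℝ → X} (h : IsGeod x y γ) (hxy : x ≠ y) :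
    IsArc x y (γ '' Icc 0 (dist x y)) := by
  have hD : 0 < dist x y := dist_pos.2 hxy
  have hmaps : MapsTo (fun s : ℝ => s * dist x y) (Icc 0 1) (Icc 0 (dist x y)) := by
    intro s hs
    exact ⟨mul_nonneg hs.1 hD.le, by nlinarith [hs.2]⟩
  refine ⟨fun s => γ (s * dist x y), ?_, ?_, ?_, ?_, ?_⟩
  · exact h.continuousOn.comp (by fun_prop) hmaps
  · intro s hs t ht hst
    have := h.2.2 _ (hmaps hs) _ (hmaps ht)
    simp only at hst
    rw [hst, dist_self, eq_comm, abs_eq_zero, sub_eq_zero] at this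
    exact mul_right_cancel₀ hD.ne' this
  · simp [h.1]
  · simp [h.2.1]
  · ext z
    constructor
    · rintro ⟨s, hs, rfl⟩
      exact ⟨_, hmaps hs, rfl⟩
    · rintro ⟨t, ht, rfl⟩
      refine ⟨t / dist x y, ⟨div_nonneg ht.1 hD.le, (div_le_one hD).2 ht.2⟩, ?_⟩
      simp only
      rw [div_mul_cancel₀ _ hD.ne']

/-- In a `0`-hyperbolic space, a connected set contains the metric segments between its points. -/
theorem FourPoint.mem_of_isPreconnected (hX : FourPoint X) {C : Set X} (hC : IsPreconnected C)
    {x y z : X} (hx : x ∈ C) (hy : y ∈ C) (hz : z ∈ segm x y) : z ∈ C := by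
  by_contra hzC
  have hzx : x ≠ z := fun h => hzC (h ▸ hx)
  have hzy : y ≠ z := fun h => hzC (h ▸ hy)
  simp only [segm, mem_ofPred_eq] at hz
  let U : Set X := {w | dist x w < dist x z + dist z w}
  let V : Set X := ⋃ w ∈ {w : X | w ≠ z ∧ w ∉ U}, ball w (dist w z)
  have hU : IsOpen U := isOpen_lt (by fun_prop) (by fun_prop)
  have hV : IsOpen V := isOpen_biUnion fun _ _ => isOpen_ball
  have hmemV : ∀ w, w ≠ z → w ∉ U → w ∈ V := fun w h1 h2 =>
    mem_biUnion (show w ∈ {w : X | w ≠ z ∧ w ∉ U} from ⟨h1, h2⟩) (mem_ball_self (dist_pos.2 h1))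
  obtain ⟨w, -, hwU, hwV⟩ := hC U V hU hV
    (fun w hw => by
      by_cases h : w ∈ U
      · exact Or.inl h
      · exact Or.inr (hmemV w (fun h' => hzC (h' ▸ hw)) h))
    ⟨x, hx, by
      have := dist_pos.2 hzx
      simp only [U, mem_ofPred_eq, dist_self]
      linarith [dist_nonneg (x := z) (y := x)]⟩
    ⟨y, hy, hmemV y hzy (by simp only [U, mem_ofPred_eq]; linarith)⟩
  obtain ⟨v, ⟨hvz, hvU⟩, hwv⟩ := mem_iUnion₂.1 hwV
  simp only [U, mem_ofPred_eq, not_lt] at hwU hvU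
  rw [mem_ball] at hwv
  have := hX z x w v
  rw [dist_comm z x, dist_comm v z] at *
  rcases le_max_iff.1 this with h | h <;> linarith [dist_nonneg (x := z) (y := w)]

theorem FourPoint.isArc_eq_segm (hX : FourPoint X)
    (hG : ∀ x y : X, ∃ γ, IsGeod x y γ) {x y : X} {A : Set X} (hA : IsArc x y A) :
    A = segm x y := by
  obtain ⟨γ, hc, hinj, h0, h1, rfl⟩ := hA
  have m0 : (0 : ℝ) ∈ Icc (0 : ℝ) 1 := ⟨le_rfl, zero_le_one⟩
  have m1 : (1 : ℝ) ∈ Icc (0 : ℝ) 1 := ⟨zero_le_one, le_rfl⟩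
  apply Subset.antisymm
  · rintro _ ⟨s, hs, rfl⟩
    have s1 : Icc 0 s ⊆ Icc (0 : ℝ) 1 := Icc_subset_Icc_right hs.2
    have s2 : Icc s 1 ⊆ Icc (0 : ℝ) 1 := Icc_subset_Icc_left hs.1
    have c1 : IsPreconnected (γ '' Icc 0 s) := isPreconnected_Icc.image _ (hc.mono s1)
    have c2 : IsPreconnected (γ '' Icc s 1) := isPreconnected_Icc.image _ (hc.mono s2)
    obtain ⟨g, hg⟩ := hG (γ s) x
    set w := γ s with hw
    set τ := (dist w x + dist w y - dist x y) / 2 with hτ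
    have hτm : τ ∈ Icc (0 : ℝ) (dist w x) := by
      constructor
      · have := dist_triangle x w y
        rw [dist_comm x w] at this
        linarith
      · have := dist_triangle w x y
        linarith
    obtain ⟨hseg, hdist⟩ := hg.mem_segm hτm
    have hseg' : g τ ∈ segm w y := by
      simp only [segm, mem_ofPred_eq] at *
      have h4 := hX w (g τ) x y
      have h5 := dist_triangle w (g τ) y
      rcases le_max_iff.1 h4 with h | h <;> rw [dist_comm w (g τ)] at * <;> linarith
    obtain ⟨t1, ht1, e1⟩ := hX.mem_of_isPreconnected c1
      (mem_image_of_mem γ ⟨hs.1, le_rfl⟩) (mem_image_of_mem γ ⟨le_rfl, hs.1⟩)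
      (show g τ ∈ segm (γ s) (γ 0) by rw [h0]; exact hseg)
    obtain ⟨t2, ht2, e2⟩ := hX.mem_of_isPreconnected c2
      (mem_image_of_mem γ ⟨le_rfl, hs.2⟩) (mem_image_of_mem γ ⟨hs.2, le_rfl⟩)
      (show g τ ∈ segm (γ s) (γ 1) by rw [h1]; exact hseg')
    have ht : t1 = t2 := hinj (s1 ht1) (s2 ht2) (e1.trans e2.symm)
    have hts : t1 = s := le_antisymm ht1.2 (ht ▸ ht2.1)
    rw [hts] at e1
    rw [← e1, hw, dist_self] at hdist
    simp only [segm, mem_ofPred_eq]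
    rw [dist_comm x w]
    linarith
  · intro z hz
    exact hX.mem_of_isPreconnected (isPreconnected_Icc.image _ hc)
      ⟨0, m0, h0⟩ ⟨1, m1, h1⟩ hz

/-- Geodesic `0`-hyperbolic spaces are `ℝ`-trees. -/
theorem FourPoint.isRTree (hX : FourPoint X) (hG : ∀ x y : X, ∃ γ, IsGeod x y γ) :
    IsRTree X := by
  intro x y hxy
  obtain ⟨γ, hγ⟩ := hG x y
  refine ⟨⟨_, hγ.isArc hxy⟩, fun A B hA hB => ?_, fun A hA => ?_⟩
  · rw [hX.isArc_eq_segm hG hA, hX.isArc_eq_segm hG hB]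
  · refine ⟨γ, hγ.1, hγ.2.1, hγ.2.2, ?_⟩
    rw [hX.isArc_eq_segm hG hA, hX.isArc_eq_segm hG (hγ.isArc hxy)]

theorem IsArc.concat {x c y : X} {A B : Set X} (hA : IsArc x c A) (hB : IsArc c y B)
    (hAB : A ∩ B ⊆ {c}) : IsArc x y (A ∪ B) := by
  obtain ⟨f, fc, fi, f0, f1, rfl⟩ := hA
  obtain ⟨g, gc, gi, g0, g1, rfl⟩ := hB
  have hcross : ∀ s t : ℝ, 0 ≤ s → s ≤ 1 / 2 → 1 / 2 < t → t ≤ 1 → f (2 * s) ≠ g (2 * t - 1) := by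
    intro s t hs0 hs ht ht1 he
    have hgc : g (2 * t - 1) = c := by
      apply hAB
      exact ⟨⟨2 * s, ⟨by linarith, by linarith⟩, he⟩, ⟨2 * t - 1, ⟨by linarith, by linarith⟩, rfl⟩⟩
    have := gi (show 2 * t - 1 ∈ Icc (0 : ℝ) 1 from ⟨by linarith, by linarith⟩)
      (show (0 : ℝ) ∈ Icc (0 : ℝ) 1 from ⟨le_rfl, zero_le_one⟩) (hgc.trans g0.symm)
    linarith
  refine ⟨fun t => if t ≤ 1 / 2 then f (2 * t) else g (2 * t - 1), ?_, ?_, ?_, ?_, ?_⟩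
  · have h1 : ContinuousOn (fun t : ℝ => if t ≤ 1 / 2 then f (2 * t) else g (2 * t - 1))
        (Icc 0 (1 / 2)) := by
      have : ContinuousOn (fun t : ℝ => f (2 * t)) (Icc 0 (1 / 2)) :=
        fc.comp (by fun_prop) fun t ht => ⟨by linarith [ht.1], by linarith [ht.2]⟩
      exact this.congr fun t ht => if_pos ht.2
    have h2 : ContinuousOn (fun t : ℝ => if t ≤ 1 / 2 then f (2 * t) else g (2 * t - 1))
        (Icc (1 / 2) 1) := by
      have : ContinuousOn (fun t : ℝ => g (2 * t - 1)) (Icc (1 / 2) 1) :=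
        gc.comp (by fun_prop) fun t ht => ⟨by linarith [ht.1], by linarith [ht.2]⟩
      refine this.congr fun t ht => ?_
      by_cases h : t ≤ 1 / 2
      · have : t = 1 / 2 := le_antisymm h ht.1
        subst this
        norm_num [f1, g0]
      · exact if_neg h
    have h3 := h1.union_of_isClosed h2 isClosed_Icc isClosed_Icc
    rwa [Icc_union_Icc_eq_Icc (by norm_num) (by norm_num)] at h3
  · intro s hs t ht hst
    simp only at hst
    split_ifs at hst with h1 h2 h2
    · have := fi (show 2 * s ∈ Icc (0 : ℝ) 1 from ⟨by linarith [hs.1], by linarith⟩)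
        (show 2 * t ∈ Icc (0 : ℝ) 1 from ⟨by linarith [ht.1], by linarith⟩) hst
      linarith
    · exact absurd hst (hcross s t hs.1 h1 (not_le.1 h2) ht.2)
    · exact absurd hst.symm (hcross t s ht.1 h2 (not_le.1 h1) hs.2)
    · have := gi (show 2 * s - 1 ∈ Icc (0 : ℝ) 1 from ⟨by linarith, by linarith [hs.2]⟩)
        (show 2 * t - 1 ∈ Icc (0 : ℝ) 1 from ⟨by linarith, by linarith [ht.2]⟩) hst
      linarith
  · simp [f0]
  · norm_num [g1]
  · ext z
    constructor
    · rintro ⟨t, ht, rfl⟩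
      simp only
      split_ifs with h
      · exact Or.inl ⟨2 * t, ⟨by linarith [ht.1], by linarith⟩, rfl⟩
      · exact Or.inr ⟨2 * t - 1, ⟨by linarith, by linarith [ht.2]⟩, rfl⟩
    · rintro (⟨t, ht, rfl⟩ | ⟨t, ht, rfl⟩)
      · refine ⟨t / 2, ⟨by linarith [ht.1], by linarith [ht.2]⟩, ?_⟩
        have : t / 2 ≤ 1 / 2 := by linarith [ht.2]
        simp only [if_pos this]
        congr 1
        ring
      · by_cases h0 : t = 0
        · refine ⟨1 / 2, by norm_num, ?_⟩
          subst h0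
          norm_num [f1, g0]
        · have hpos : 0 < t := lt_of_le_of_ne ht.1 (Ne.symm h0)
          refine ⟨(t + 1) / 2, ⟨by linarith, by linarith [ht.2]⟩, ?_⟩
          have : ¬ (t + 1) / 2 ≤ 1 / 2 := by linarith
          simp only [if_neg this]
          congr 1
          ring

theorem IsRTree.exists_isGeod (hX : IsRTree X) {x y : X} (hxy : x ≠ y) :
    ∃ γ, IsGeod x y γ ∧ IsArc x y (γ '' Icc 0 (dist x y)) := by
  obtain ⟨⟨A, hA⟩, -, h⟩ := hX x y hxy
  obtain ⟨γ, h0, h1, h2, h3⟩ := h A hA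
  exact ⟨γ, ⟨h0, h1, h2⟩, h3.symm ▸ hA⟩

theorem IsRTree.geod_image_eq_segm (hX : IsRTree X) {x y : X} {γ : ℝ → X} (hxy : x ≠ y)
    (hγ : IsGeod x y γ) : γ '' Icc 0 (dist x y) = segm x y := by
  apply Subset.antisymm
  · rintro _ ⟨t, ht, rfl⟩
    exact (hγ.mem_segm ht).1
  · intro z hz
    by_cases hxz : x = z
    · exact ⟨0, ⟨le_rfl, dist_nonneg⟩, hγ.1.trans hxz⟩
    by_cases hzy : z = y
    · exact ⟨dist x y, ⟨dist_nonneg, le_rfl⟩, hγ.2.1.trans hzy.symm⟩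
    obtain ⟨f, hf, hfA⟩ := hX.exists_isGeod hxz
    obtain ⟨g, hg, hgA⟩ := hX.exists_isGeod hzy
    have harc := hfA.concat hgA (by
      rintro p ⟨⟨s, hs, rfl⟩, ⟨t, ht, hst⟩⟩
      have h1 := (hf.mem_segm hs).1
      have h2 := (hg.mem_segm ht).1
      rw [hst] at h2
      simp only [segm, mem_ofPred_eq] at h1 h2 hz
      have h3 := dist_triangle x (f s) y
      rw [dist_comm z (f s)] at h2
      exact dist_le_zero.1 (by linarith))
    rw [(hX x y hxy).2.1 _ _ (hγ.isArc hxy) harc]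
    exact Or.inl ⟨dist x z, ⟨dist_nonneg, le_rfl⟩, hf.2.1⟩

theorem IsRTree.isArc_segm (hX : IsRTree X) {x y : X} (hxy : x ≠ y) : IsArc x y (segm x y) := by
  obtain ⟨γ, hγ, hA⟩ := hX.exists_isGeod hxy
  rwa [hX.geod_image_eq_segm hxy hγ] at hA

theorem IsRTree.dist_of_mem_segm (hX : IsRTree X) {x y u v : X} (hu : u ∈ segm x y)
    (hv : v ∈ segm x y) : dist u v = |dist x u - dist x v| := by
  by_cases hxy : x = y
  · subst hxy
    simp only [segm, mem_ofPred_eq, dist_self] at hu hv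
    have hu' : x = u := dist_le_zero.1 (by linarith [dist_nonneg (x := u) (y := x)])
    have hv' : x = v := dist_le_zero.1 (by linarith [dist_nonneg (x := v) (y := x)])
    rw [← hu', ← hv']
    simp
  · obtain ⟨γ, hγ, -⟩ := hX.exists_isGeod hxy
    rw [← hX.geod_image_eq_segm hxy hγ] at hu hv
    obtain ⟨s, hs, rfl⟩ := hu
    obtain ⟨t, ht, rfl⟩ := hv
    rw [(hγ.mem_segm hs).2, (hγ.mem_segm ht).2]
    exact hγ.2.2 s hs t ht

theorem IsRTree.mem_segm_of_inter (hX : IsRTree X) {w c y : X}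
    (h : segm w c ∩ segm c y ⊆ {c}) : c ∈ segm w y := by
  by_cases hwc : w = c
  · rw [hwc]; exact left_mem_segm _ _
  by_cases hcy : c = y
  · rw [hcy]; exact right_mem_segm _ _
  have harc := (hX.isArc_segm hwc).concat (hX.isArc_segm hcy) h
  have hwy : w ≠ y := by
    rintro rfl
    exact hwc (h ⟨left_mem_segm _ _, right_mem_segm _ _⟩)
  rw [(hX w y hwy).2.1 _ _ (hX.isArc_segm hwy) harc]
  exact Or.inl (right_mem_segm _ _)

/-- Three points of an `ℝ`-tree have a median. -/
theorem IsRTree.exists_median (hX : IsRTree X) (w x y : X) :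
    ∃ c, c ∈ segm x y ∧ c ∈ segm w x ∧ c ∈ segm w y := by
  by_cases hxy : x = y
  · subst hxy
    exact ⟨x, left_mem_segm _ _, right_mem_segm _ _, right_mem_segm _ _⟩
  obtain ⟨γ, hγ, -⟩ := hX.exists_isGeod hxy
  have hcomp : IsCompact (segm x y) := by
    rw [← hX.geod_image_eq_segm hxy hγ]
    exact isCompact_Icc.image_of_continuousOn hγ.continuousOn
  obtain ⟨c, hc, hmin⟩ := hcomp.exists_isMinOn ⟨x, left_mem_segm x y⟩
    (f := fun z => dist w z) (by fun_prop)
  have key : ∀ p ∈ segm w c, p ∈ segm x y → p = c := by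
    intro p hp hp'
    have h1 : dist w c ≤ dist w p := hmin hp'
    simp only [segm, mem_ofPred_eq] at hp
    exact dist_le_zero.1 (by linarith)
  refine ⟨c, hc, hX.mem_segm_of_inter ?_, hX.mem_segm_of_inter ?_⟩
  · rintro p ⟨h1, h2⟩
    refine key p h1 ?_
    rw [segm_comm] at hc ⊢
    exact segm_subset_of_mem hc h2
  · rintro p ⟨h1, h2⟩
    exact key p h1 (segm_subset_of_mem hc h2)

/-- The Gromov product. -/
def gromov (o a b : X) : ℝ := (dist o a + dist o b - dist a b) / 2

theorem IsRTree.dist_le_of_gromov (hX : IsRTree X) {o x y z : X}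
    (h : gromov o x y ≤ gromov o y z) : gromov o x y ≤ gromov o x z := by
  obtain ⟨u, u1, u2, u3⟩ := hX.exists_median o x y
  obtain ⟨v, v1, v2, v3⟩ := hX.exists_median o y z
  have huv := hX.dist_of_mem_segm u3 v2
  simp only [segm, mem_ofPred_eq, gromov] at *
  rw [dist_comm x u] at u1
  rw [dist_comm y v] at v1
  have h1 : dist o u ≤ dist o v := by linarith
  rw [abs_sub_comm, abs_of_nonneg (sub_nonneg.2 h1)] at huv
  have t1 := dist_triangle4 x u v z
  rw [dist_comm x u] at t1
  linarith

end RTree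

/-- A symmetric function satisfying the (reversed) ultrametric inequality. -/
structure IsTreeKernel {P : Type*} (m : P → P → ℝ) : Prop where
  symm : ∀ p q, m p q = m q p
  min_le : ∀ p q r, min (m p q) (m q r) ≤ m p r

namespace IsTreeKernel

variable {P : Type*} {m : P → P → ℝ}

theorem le_left (hm : IsTreeKernel m) (p q : P) : m p q ≤ m p p := by
  simpa [hm.symm q p] using hm.min_le p q p

theorem le_right (hm : IsTreeKernel m) (p q : P) : m p q ≤ m q q :=
  hm.symm p q ▸ hm.le_left q p

/-- The pseudometric with `m p q` as the height of the branching point of `p` and `q`. -/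
abbrev pseudoMetricSpace (hm : IsTreeKernel m) : PseudoMetricSpace P where
  dist p q := m p p + m q q - 2 * m p q
  dist_self p := by ring
  dist_comm p q := by rw [hm.symm p q]; ring
  dist_triangle p q r := by
    have h1 := hm.le_right p q
    have h2 := hm.le_left q r
    rcases min_le_iff.1 (hm.min_le p q r) with h | h <;> linarith

theorem fourPoint (hm : IsTreeKernel m) : @FourPoint P hm.pseudoMetricSpace := by
  intro o x y z
  have h1 := hm.min_le x y z
  have h2 := hm.min_le x o z
  have h3 := hm.min_le o x y
  have h4 := hm.min_le o z y
  rw [hm.symm x o] at h2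
  rw [hm.symm z y] at h4
  change m x x + m z z - 2 * m x z + (m o o + m y y - 2 * m o y) ≤
    max (m x x + m y y - 2 * m x y + (m o o + m z z - 2 * m o z))
      (m y y + m z z - 2 * m y z + (m o o + m x x - 2 * m o x))
  rw [le_max_iff]
  by_contra! hcon
  obtain ⟨c1, c2⟩ := hcon
  rcases min_le_iff.1 h1 with h1 | h1 <;> rcases min_le_iff.1 h2 with h2 | h2 <;>
    rcases min_le_iff.1 h3 with h3 | h3 <;> rcases min_le_iff.1 h4 with h4 | h4 <;> linarith

/-- Points of the branches below the elements of `P`. -/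
structure Pt (_hm : IsTreeKernel m) where
  /-- An element whose branch contains the point. -/
  base : P
  /-- The height of the point. -/
  height : ℝ
  height_le : height ≤ m base base

/-- The branching height of two points on branches. -/
def ptKernel (hm : IsTreeKernel m) (x y : hm.Pt) : ℝ := min (min x.height y.height) (m x.base y.base)

theorem ptKernel_self (hm : IsTreeKernel m) (x : hm.Pt) : hm.ptKernel x x = x.height := by
  simp [ptKernel, x.height_le]

theorem isTreeKernel_ptKernel (hm : IsTreeKernel m) : IsTreeKernel hm.ptKernel where
  symm x y := by
    unfold ptKernel
    rw [hm.symm, min_comm x.height]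
  min_le x y z := by
    have h := hm.min_le x.base y.base z.base
    unfold ptKernel
    refine le_min (le_min ?_ ?_) (le_trans ?_ h)
    · exact (min_le_left _ _).trans ((min_le_left _ _).trans (min_le_left _ _))
    · exact (min_le_right _ _).trans ((min_le_left _ _).trans (min_le_right _ _))
    · exact min_le_min (min_le_right _ _) (min_le_right _ _)

instance (hm : IsTreeKernel m) : PseudoMetricSpace hm.Pt :=
  hm.isTreeKernel_ptKernel.pseudoMetricSpace

/-- The `ℝ`-tree spanned by a tree kernel. -/
abbrev Tree (hm : IsTreeKernel m) := SeparationQuotient hm.Pt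

/-- The projection of branch points to the tree. -/
def toTree (hm : IsTreeKernel m) (x : hm.Pt) : hm.Tree := SeparationQuotient.mk x

theorem toTree_surjective (hm : IsTreeKernel m) : Function.Surjective hm.toTree :=
  SeparationQuotient.surjective_mk

theorem dist_toTree (hm : IsTreeKernel m) (x y : hm.Pt) :
    dist (hm.toTree x) (hm.toTree y) = x.height + y.height - 2 * hm.ptKernel x y := by
  rw [← hm.ptKernel_self x, ← hm.ptKernel_self y]
  exact SeparationQuotient.dist_mk x y

theorem fourPoint_tree (hm : IsTreeKernel m) : FourPoint hm.Tree := by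
  intro o x y z
  obtain ⟨o, rfl⟩ := hm.toTree_surjective o
  obtain ⟨x, rfl⟩ := hm.toTree_surjective x
  obtain ⟨y, rfl⟩ := hm.toTree_surjective y
  obtain ⟨z, rfl⟩ := hm.toTree_surjective z
  exact hm.isTreeKernel_ptKernel.fourPoint o x y z

theorem exists_isGeod (hm : IsTreeKernel m) (x y : hm.Tree) : ∃ γ, IsGeod x y γ := by
  obtain ⟨⟨p, t, ht⟩, rfl⟩ := hm.toTree_surjective x
  obtain ⟨⟨q, s, hs⟩, rfl⟩ := hm.toTree_surjective y
  set μ := min (min t s) (m p q) with hμ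
  have hμt : μ ≤ t := (min_le_left _ _).trans (min_le_left _ _)
  have hμs : μ ≤ s := (min_le_left _ _).trans (min_le_right _ _)
  have hμm : μ ≤ m p q := min_le_right _ _
  let up : ℝ → hm.Pt := fun r => ⟨p, min t (t - r), (min_le_left _ _).trans ht⟩
  let down : ℝ → hm.Pt := fun r => ⟨q, min s (2 * μ - t + r), (min_le_left _ _).trans hs⟩
  have hD : dist (hm.toTree ⟨p, t, ht⟩) (hm.toTree ⟨q, s, hs⟩) = t + s - 2 * μ := hm.dist_toTree _ _
  have huu : ∀ a b : ℝ, 0 ≤ a → a ≤ b → dist (hm.toTree (up a)) (hm.toTree (up b)) = b - a := by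
    intro a b ha hab
    rw [dist_toTree]
    simp only [up, ptKernel]
    rw [min_eq_right (by linarith : t - a ≤ t), min_eq_right (by linarith : t - b ≤ t),
      min_eq_right (by linarith : t - b ≤ t - a), min_eq_left (by linarith : t - b ≤ m p p)]
    ring
  have hdd : ∀ a b : ℝ, a ≤ b → b ≤ t + s - 2 * μ →
      dist (hm.toTree (down a)) (hm.toTree (down b)) = b - a := by
    intro a b hab hb
    rw [dist_toTree]
    simp only [down, ptKernel]
    rw [min_eq_right (by linarith : 2 * μ - t + a ≤ s), min_eq_right (by linarith : 2 * μ - t + b ≤ s),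
      min_eq_left (by linarith : 2 * μ - t + a ≤ 2 * μ - t + b),
      min_eq_left (by linarith : 2 * μ - t + a ≤ m q q)]
    ring
  have hud : ∀ a b : ℝ, 0 ≤ a → a ≤ t - μ → t - μ ≤ b → b ≤ t + s - 2 * μ →
      dist (hm.toTree (up a)) (hm.toTree (down b)) = b - a := by
    intro a b ha hab hab' hb
    rw [dist_toTree]
    simp only [up, down, ptKernel]
    rw [min_eq_right (by linarith : t - a ≤ t), min_eq_right (by linarith : 2 * μ - t + b ≤ s)]
    have : min (min (t - a) (2 * μ - t + b)) (m p q) = μ := by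
      apply le_antisymm
      · rw [hμ]
        exact le_min (le_min ((min_le_left _ _).trans ((min_le_left _ _).trans (by linarith)))
          ((min_le_left _ _).trans ((min_le_right _ _).trans (by linarith)))) (min_le_right _ _)
      · exact le_min (le_min (by linarith) (by linarith)) hμm
    rw [this]
    ring
  let γ : ℝ → hm.Tree := fun r => if r ≤ t - μ then hm.toTree (up r) else hm.toTree (down r)
  have hle : ∀ a b : ℝ, 0 ≤ a → a ≤ b → b ≤ t + s - 2 * μ → dist (γ a) (γ b) = b - a := by
    intro a b ha hab hb
    simp only [γ]
    split_ifs with h1 h2 h2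
    · exact huu a b ha hab
    · exact hud a b ha h1 (not_le.1 h2).le hb
    · linarith
    · exact hdd a b hab hb
  refine ⟨γ, ?_, ?_, ?_⟩
  · simp only [γ]
    rw [if_pos (by linarith)]
    congr 1
    simp [up]
  · rw [hD]
    simp only [γ]
    split_ifs with h
    · have hs' : s = μ := by linarith
      apply dist_le_zero.1
      rw [dist_toTree]
      simp only [up, ptKernel]
      have e : t - (t + s - 2 * μ) = μ := by linarith
      rw [e, min_eq_right hμt, min_eq_left (by linarith : μ ≤ s), min_eq_left hμm]
      linarith
    · congr 1
      simp only [down, Pt.mk.injEq, true_and]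
      exact min_eq_left (by linarith)
  · rw [hD]
    intro a ha b hb
    rcases le_total a b with hab | hab
    · rw [hle a b ha.1 hab hb.2, abs_sub_comm, abs_of_nonneg (sub_nonneg.2 hab)]
    · rw [dist_comm, hle b a hb.1 hab ha.2, abs_of_nonneg (sub_nonneg.2 hab)]

theorem isRTree_tree (hm : IsTreeKernel m) : IsRTree hm.Tree :=
  hm.fourPoint_tree.isRTree hm.exists_isGeod

/-- The top of the branch of `p`. -/
def leaf (hm : IsTreeKernel m) (p : P) : hm.Tree := hm.toTree ⟨p, m p p, le_rfl⟩

theorem dist_leaf (hm : IsTreeKernel m) (p q : P) :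
    dist (hm.leaf p) (hm.leaf q) = m p p + m q q - 2 * m p q := by
  unfold leaf
  rw [dist_toTree]
  simp only [ptKernel]
  rw [min_eq_right (le_min (hm.le_left p q) (hm.le_right p q))]

end IsTreeKernel

section Lamps

variable {T : Type*}

/-- The finite set `{x, y} ∪ (A Δ B)` of sites to be visited. -/
def sites (p q : Lamp T) : Finset T := insert p.2 (insert q.2 (symmDiff p.1 q.1))

theorem mem_sites {p q : Lamp T} {a : T} :
    a ∈ sites p q ↔ a = p.2 ∨ a = q.2 ∨ a ∈ sd p q := by
  simp [sites, sd, Finset.mem_symmDiff]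

theorem left_mem_sites (p q : Lamp T) : p.2 ∈ sites p q := by simp [sites]

theorem right_mem_sites (p q : Lamp T) : q.2 ∈ sites p q := by simp [sites]

theorem sites_comm (p q : Lamp T) : sites p q = sites q p := by
  unfold sites
  rw [symmDiff_comm, Finset.insert_comm]

theorem sites_self (p : Lamp T) : sites p p = {p.2} := by simp [sites]

theorem sites_subset (p q r : Lamp T) {a : T} (ha : a ∈ sites p r) :
    a ∈ sites p q ∨ a ∈ sites q r := by
  simp only [mem_sites, sd, mem_union, mem_sdiff, Finset.mem_coe] at *
  tauto

theorem sites_product_nonempty (p q : Lamp T) : (sites p q ×ˢ sites p q).Nonempty :=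
  ⟨(p.2, p.2), by simp [left_mem_sites]⟩

/-- The lift of a kernel to the lamplighter space: the minimum over all pairs of sites. -/
def lampKernel (g : T → T → ℝ) (p q : Lamp T) : ℝ :=
  (sites p q ×ˢ sites p q).inf' (sites_product_nonempty p q) fun x => g x.1 x.2

theorem lampKernel_le (g : T → T → ℝ) {p q : Lamp T} {a b : T} (ha : a ∈ sites p q)
    (hb : b ∈ sites p q) : lampKernel g p q ≤ g a b :=
  Finset.inf'_le (fun x : T × T => g x.1 x.2) (Finset.mk_mem_product ha hb)

theorem le_lampKernel {g : T → T → ℝ} {p q : Lamp T} {c : ℝ}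
    (h : ∀ a ∈ sites p q, ∀ b ∈ sites p q, c ≤ g a b) : c ≤ lampKernel g p q :=
  Finset.le_inf' _ _ fun _ hx => h _ (Finset.mem_product.1 hx).1 _ (Finset.mem_product.1 hx).2

theorem lampKernel_self (g : T → T → ℝ) (p : Lamp T) : lampKernel g p p = g p.2 p.2 :=
  le_antisymm (lampKernel_le g (left_mem_sites p p) (left_mem_sites p p)) <| le_lampKernel (by
    simp [sites_self])

theorem isTreeKernel_lampKernel {g : T → T → ℝ} (hg : IsTreeKernel g) :
    IsTreeKernel (lampKernel g) where
  symm p q := by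
    apply le_antisymm <;> refine le_lampKernel fun a ha b hb => lampKernel_le g ?_ ?_ <;>
      rwa [sites_comm]
  min_le p q r := by
    refine le_lampKernel fun a ha b hb => ?_
    rcases sites_subset p q r ha with ha | ha <;> rcases sites_subset p q r hb with hb | hb
    · exact (min_le_left _ _).trans (lampKernel_le g ha hb)
    · exact (min_le_min (lampKernel_le g ha (right_mem_sites p q))
        (lampKernel_le g (left_mem_sites q r) hb)).trans (hg.min_le _ _ _)
    · rw [min_comm]
      exact (min_le_min (lampKernel_le g ha (left_mem_sites q r))
        (lampKernel_le g (right_mem_sites p q) hb)).trans (hg.min_le _ _ _)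
    · exact (min_le_right _ _).trans (lampKernel_le g ha hb)

/-- The kernel of the discrete metric on lamp configurations. -/
def discreteKernel (p q : Lamp T) : ℝ := if p.1 = q.1 then 1 / 2 else 0

theorem isTreeKernel_discreteKernel : IsTreeKernel (discreteKernel (T := T)) where
  symm p q := by simp only [discreteKernel, eq_comm]
  min_le p q r := by
    unfold discreteKernel
    split_ifs with h1 h2 h3 <;> simp_all

theorem isTreeKernel_min_neg (h : T → ℝ) :
    IsTreeKernel (fun a b => min (-h a) (-h b)) where
  symm _ _ := min_comm _ _
  min_le _ _ _ := le_min ((min_le_left _ _).trans (min_le_left _ _))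
    ((min_le_right _ _).trans (min_le_right _ _))

theorem rho_nonneg (p q : Lamp T) : 0 ≤ rho p q := by
  unfold rho
  split_ifs <;> norm_num

/-- The tree pseudometric of the lift of a kernel to the lamplighter space. -/
def lampDist (g : T → T → ℝ) (p q : Lamp T) : ℝ :=
  lampKernel g p p + lampKernel g q q - 2 * lampKernel g p q

theorem lampDist_ge (g : T → T → ℝ) {p q : Lamp T} {a : T}
    (ha : a ∈ sites p q) : g p.2 p.2 - g p.2 a ≤ lampDist g p q := by
  have h1 := lampKernel_le g (left_mem_sites p q) ha
  have h2 := lampKernel_le g (right_mem_sites p q) (right_mem_sites p q)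
  rw [lampDist, lampKernel_self, lampKernel_self]
  linarith

theorem lampDist_nonneg (g : T → T → ℝ) (p q : Lamp T) :
    0 ≤ lampDist g p q := by
  simpa using lampDist_ge g (left_mem_sites p q)

variable [MetricSpace T]

theorem IsRTree.isTreeKernel_gromov (hT : IsRTree T) (o : T) : IsTreeKernel (gromov o) where
  symm a b := by
    unfold gromov
    rw [dist_comm a b]; ring
  min_le a b c := by
    rcases le_total (gromov o a b) (gromov o b c) with h | h
    · exact (min_le_left _ _).trans (hT.dist_le_of_gromov h)
    · have hs : ∀ x y : T, gromov o x y = gromov o y x := fun x y => by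
        unfold gromov
        rw [dist_comm x y]; ring
      rw [hs a b, hs b c] at *
      rw [hs a c]
      exact (min_le_right _ _).trans (hT.dist_le_of_gromov h)

theorem pathLength_nonneg (l : List T) : 0 ≤ pathLength dist l := by
  induction l with
  | nil => simp [pathLength]
  | cons x l ih =>
    cases l with
    | nil => simp [pathLength]
    | cons y l =>
      simp only [pathLength]
      positivity

theorem dist_head_le_pathLength (x : T) (l : List T) :
    ∀ a ∈ x :: l, dist x a ≤ pathLength dist (x :: l) := by
  induction l generalizing x with
  | nil => simp [pathLength]
  | cons y l ih =>
    intro a ha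
    rcases List.mem_cons.1 ha with rfl | ha
    · simpa using pathLength_nonneg _
    · have := ih y a ha
      have := dist_triangle x y a
      simp only [pathLength] at *
      linarith

theorem dist_le_pathLength (l : List T) :
    ∀ a ∈ l, ∀ b ∈ l, dist a b ≤ pathLength dist l := by
  induction l with
  | nil => simp
  | cons x l ih =>
    intro a ha b hb
    rcases List.mem_cons.1 ha with rfl | ha'
    · exact dist_head_le_pathLength _ _ _ hb
    · rcases List.mem_cons.1 hb with rfl | hb'
      · rw [dist_comm]
        exact dist_head_le_pathLength _ _ _ ha
      · refine (ih a ha' b hb').trans ?_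
        cases l with
        | nil => simp at ha'
        | cons y l =>
          simp only [pathLength]
          linarith [dist_nonneg (x := x) (y := y)]

theorem dist_le_TSP {p q : Lamp T} {a b : T} (ha : a ∈ sites p q) (hb : b ∈ sites p q) :
    dist a b ≤ TSP dist p q := by
  apply le_csInf
  · refine ⟨_, p.2 :: ((sites p q).toList ++ [q.2]), by simp, ?_, ?_, rfl⟩
    · rw [← List.cons_append, List.getLast?_append]
      simp
    · intro a ha
      have : a ∈ sites p q := mem_sites.2 (Or.inr (Or.inr ha))
      simp [this]
  · rintro s ⟨l, h1, h2, h3, rfl⟩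
    have hmem : ∀ a ∈ sites p q, a ∈ l := by
      intro a ha
      rcases mem_sites.1 ha with rfl | rfl | ha
      · exact List.mem_of_mem_head? h1
      · exact List.mem_of_getLast? h2
      · exact h3 a ha
    exact dist_le_pathLength l a (hmem a ha) b (hmem b hb)

theorem TSCP_le {p q : Lamp T} {c : ℝ}
    (h : ∀ a ∈ sites p q, ∀ b ∈ sites p q, dist a b ≤ c) : TSCP dist p q ≤ c := by
  have hc : 0 ≤ c := dist_nonneg.trans (h _ (left_mem_sites p q) _ (right_mem_sites p q))
  have hmem : ∀ a ∈ ({p.2, q.2} ∪ sd p q : Set T), a ∈ sites p q := by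
    intro a ha
    rw [mem_sites]
    simpa [or_assoc] using ha
  refine ENNReal.toReal_le_of_le_ofReal hc ?_
  exact iSup₂_le fun a ha => iSup₂_le fun b hb =>
    ENNReal.ofReal_le_ofReal (h a (hmem a ha) b (hmem b hb))

theorem TSCP_nonneg (p q : Lamp T) : 0 ≤ TSCP dist p q := ENNReal.toReal_nonneg

theorem dist_left_site_le (o : T) {p q : Lamp T} {a : T} (ha : a ∈ sites p q) :
    dist p.2 a ≤ 2 * (lampDist (gromov o) p q +
      lampDist (fun a b => min (-dist o a) (-dist o b)) p q) := by
  have h1 := lampDist_ge (gromov o) ha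
  have h2 := lampDist_ge (fun a b => min (-dist o a) (-dist o b)) ha
  have h3 := lampDist_nonneg (fun a b => min (-dist o a) (-dist o b)) p q
  have h4 := min_le_right (-dist o p.2) (-dist o a)
  simp only [gromov, dist_self, min_self] at *
  linarith

theorem lampDist_gromov_le (o : T) (p q : Lamp T) :
    lampDist (gromov o) p q ≤ 3 * TSP dist p q := by
  have : gromov o p.2 p.2 / 2 + gromov o q.2 q.2 / 2 - 3 / 2 * TSP dist p q ≤
      lampKernel (gromov o) p q := by
    refine le_lampKernel fun a ha b hb => ?_
    have h1 := dist_le_TSP ha hb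
    have h2 := dist_le_TSP ha (left_mem_sites p q)
    have h3 := dist_le_TSP hb (right_mem_sites p q)
    have h4 := dist_triangle o a p.2
    have h5 := dist_triangle o b q.2
    simp only [gromov, dist_self]
    linarith
  rw [lampDist, lampKernel_self, lampKernel_self]
  linarith

theorem lampDist_min_neg_le (o : T) (p q : Lamp T) :
    lampDist (fun a b => min (-dist o a) (-dist o b)) p q ≤ 2 * TSP dist p q := by
  have h : ∀ a ∈ sites p q,
      -dist o p.2 / 2 + -dist o q.2 / 2 - TSP dist p q ≤ -dist o a := by
    intro a ha
    have h2 := dist_le_TSP (left_mem_sites p q) ha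
    have h3 := dist_le_TSP (right_mem_sites p q) ha
    have h4 := dist_triangle o p.2 a
    have h5 := dist_triangle o q.2 a
    linarith
  have : -dist o p.2 / 2 + -dist o q.2 / 2 - TSP dist p q ≤
      lampKernel (fun a b => min (-dist o a) (-dist o b)) p q :=
    le_lampKernel fun a ha b hb => le_min (h a ha) (h b hb)
  rw [lampDist, lampKernel_self, lampKernel_self, min_self, min_self]
  linarith

theorem eq_of_dLa_le_zero {p q : Lamp T} (h : dLa dist p q ≤ 0) : p = q := by
  have h1 := dist_le_TSP (left_mem_sites p q) (right_mem_sites p q)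
  have h2 := rho_nonneg p q
  have h3 := dist_nonneg (x := p.2) (y := q.2)
  unfold dLa at h
  refine Prod.ext ?_ (dist_le_zero.1 (by linarith))
  by_contra hne
  have h4 : rho p q = 1 := if_neg hne
  linarith

end Lamps

/-- For every `K` there exist `m_K ∈ ℕ` and `D_K < ∞` depending only
on `K` such that for every `K`-TSP-efficient ℝ-tree `T`, the lamplighter space
`(La(T), d_La)` admits a `D_K`-biLipschitz embedding into an ℓ1-product of (at most)
`m_K` ℝ-trees. -/
theorem statement19 (K : ℝ) :
    ∃ (mK : ℕ) (DK : ℝ), 0 < DK ∧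
      ∀ (T : Type u) [MetricSpace T], IsRTree T →
        TSPEfficient (dist : T → T → ℝ) K →
        ∃ (S : Fin mK → Type u) (I : ∀ i, MetricSpace (S i)),
          (∀ i, @IsRTree (S i) (I i)) ∧
          ∃ f : Lamp T → ∀ i, S i,
            BiLipWith (dLa (dist : T → T → ℝ)) (piL1Dist I) DK f := by
  refine ⟨3, 5 * (4 * |K| + 1), by positivity, fun T _ hT hK => ?_⟩
  rcases isEmpty_or_nonempty T with hE | ⟨⟨o⟩⟩
  · refine ⟨fun _ => PUnit, fun _ => inferInstance, fun _ x y h => absurd (Subsingleton.elim x y) h,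
      fun p => isEmptyElim p.2, fun p => isEmptyElim p.2, 1, one_pos, fun p => isEmptyElim p.2⟩
  let k : Fin 3 → Lamp T → Lamp T → ℝ :=
    ![lampKernel (gromov o), lampKernel fun a b => min (-dist o a) (-dist o b), discreteKernel]
  have k0 : IsTreeKernel (lampKernel (gromov o)) :=
    isTreeKernel_lampKernel (hT.isTreeKernel_gromov o)
  have k1 : IsTreeKernel (lampKernel fun a b => min (-dist o a) (-dist o b)) :=
    isTreeKernel_lampKernel (isTreeKernel_min_neg (dist o))
  have hk : ∀ i, IsTreeKernel (k i) := by
    intro i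
    fin_cases i
    exacts [k0, k1, isTreeKernel_discreteKernel]
  refine ⟨fun i => (hk i).Tree, fun i => inferInstance, fun i => (hk i).isRTree_tree,
    fun p i => (hk i).leaf p, ?_⟩
  have hL : ∀ p q : Lamp T, piL1Dist (T := fun i => (hk i).Tree) (fun i => inferInstance)
      (fun i => (hk i).leaf p) (fun i => (hk i).leaf q) =
      lampDist (gromov o) p q + lampDist (fun a b => min (-dist o a) (-dist o b)) p q +
        rho p q := by
    intro p q
    have h2 : discreteKernel p p + discreteKernel q q - 2 * discreteKernel p q = rho p q := by
      simp only [discreteKernel, rho]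
      split_ifs <;> norm_num
    rw [← h2]
    simp only [piL1Dist, Fin.sum_univ_three, IsTreeKernel.dist_leaf, lampDist]
    rfl
  have hlow : ∀ p q : Lamp T, dLa dist p q ≤ (4 * |K| + 1) *
      (lampDist (gromov o) p q + lampDist (fun a b => min (-dist o a) (-dist o b)) p q +
        rho p q) := by
    intro p q
    have h0 := lampDist_nonneg (gromov o) p q
    have h1 := lampDist_nonneg (fun a b => min (-dist o a) (-dist o b)) p q
    have hr := rho_nonneg p q
    have h2 : TSCP dist p q ≤ 4 * (lampDist (gromov o) p q +
        lampDist (fun a b => min (-dist o a) (-dist o b)) p q) := by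
      refine TSCP_le fun a ha b hb => ?_
      have e1 := dist_left_site_le o ha
      have e2 := dist_left_site_le o hb
      have e3 := dist_triangle_left a b p.2
      linarith
    have h3 : TSP dist p q ≤ |K| * TSCP dist p q :=
      (hK p q).trans (mul_le_mul_of_nonneg_right (le_abs_self K) (TSCP_nonneg p q))
    have h4 := mul_le_mul_of_nonneg_left h2 (abs_nonneg K)
    have h5 := mul_nonneg (abs_nonneg K) hr
    unfold dLa
    linarith
  have hup : ∀ p q : Lamp T,
      lampDist (gromov o) p q + lampDist (fun a b => min (-dist o a) (-dist o b)) p q +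
        rho p q ≤ 5 * dLa dist p q := by
    intro p q
    have h0 := lampDist_gromov_le o p q
    have h1 := lampDist_min_neg_le o p q
    have hr := rho_nonneg p q
    unfold dLa
    linarith
  have hc : 0 < 4 * |K| + 1 := by positivity
  refine ⟨fun p q hpq => eq_of_dLa_le_zero ?_, (4 * |K| + 1)⁻¹, inv_pos.2 hc, fun p q => ?_⟩
  · have h := hL p q
    rw [show (fun i => (hk i).leaf p) = fun i => (hk i).leaf q from hpq] at h
    have h' : piL1Dist (T := fun i => (hk i).Tree) (fun i => inferInstance)
        (fun i => (hk i).leaf q) (fun i => (hk i).leaf q) = 0 := by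
      simp [piL1Dist]
    have := hlow p q
    rwa [← h, h', mul_zero] at this
  · rw [hL p q]
    constructor
    · rw [inv_mul_le_iff₀ hc]
      exact hlow p q
    · rw [mul_assoc 5, mul_inv_cancel₀ hc.ne', mul_one]
      exact hup p q

end Lamplighter
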